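/- Let n ≥ 1, let Λ be a skew-symmetric n×n integer matrix and T a subgroup of ℤⁿ, and assume the following super-toric condition: for every subset j ⊆ {1,…,n}, writing π_j : ℤⁿ → ℤ^j for the coordinate projection and Λ_j for the principal submatrix of Λ on the rows and columns indexed by j, the only w ∈ ℤ^j satisfying both Λ_j w = 0 and w·π_j(b) = 0 for all b ∈ T is w = 0. If I is a nonzero prime ideal of ℂ[x₁,…,xₙ] that is a Poisson ideal for the log-canonical bracket of Λ and is T-torus-invariant, then I is generated, as an ideal, by the (nonempty) set {x_i : x_i ∈ I} of variables it contains. -/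

import Mathlib

open MvPolynomial Matrix

/-- The diagonal operator scaling the monomial with exponent `u` by `φ u`. -/
noncomputable def monomialScaling {σ K : Type*} [Field K] (φ : (σ →₀ ℕ) → K) :
    MvPolynomial σ K →ₗ[K] MvPolynomial σ K :=
  (basisMonomials σ K).constr K fun u => φ u • monomial u 1

theorem monomialScaling_monomial {σ K : Type*} [Field K] (φ : (σ →₀ ℕ) → K) (u : σ →₀ ℕ) (c : K) :
    monomialScaling φ (monomial u c) = monomial u (φ u * c) := by
  have h : monomialScaling φ (monomial u 1) = φ u • monomial u 1 := by
    have := (basisMonomials σ K).constr_basis K (fun u => φ u • monomial u (1 : K)) u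
    rwa [coe_basisMonomials] at this
  have hc : monomial u c = c • monomial u (1 : K) := by simp [smul_monomial]
  rw [hc, map_smul, h, smul_smul, smul_monomial, smul_eq_mul, mul_one, mul_comm]

theorem coeff_monomialScaling {σ K : Type*} [Field K] (φ : (σ →₀ ℕ) → K) (u : σ →₀ ℕ)
    (p : MvPolynomial σ K) : coeff u (monomialScaling φ p) = φ u * coeff u p := by
  classical
  induction p using MvPolynomial.induction_on' with
  | monomial v c =>
    rw [monomialScaling_monomial, coeff_monomial, coeff_monomial]
    split_ifs with h
    · rw [h]
    · rw [mul_zero]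
  | add p q hp hq => rw [map_add, coeff_add, coeff_add, hp, hq, mul_add]

/-- A nonzero polynomial in a subspace stable under diagonal operators that separate the exponents
of the subspace forces a monomial into the subspace. -/
theorem exists_monomial_mem_of_separating_scalings {σ K : Type*} [Field K]
    (V : Submodule K (MvPolynomial σ K)) (E : Set (σ →₀ ℕ)) (Φ : Set ((σ →₀ ℕ) → K))
    (hE : ∀ u ∈ E, ∀ v ∈ E, (∀ φ ∈ Φ, φ u = φ v) → u = v)
    (hΦ : ∀ φ ∈ Φ, ∀ p ∈ V, (↑p.support : Set (σ →₀ ℕ)) ⊆ E → monomialScaling φ p ∈ V)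
    (p : MvPolynomial σ K) (hp : p ∈ V) (hpE : (↑p.support : Set (σ →₀ ℕ)) ⊆ E) (hp0 : p ≠ 0) :
    ∃ u ∈ E, monomial u (1 : K) ∈ V := by
  classical
  induction hn : p.support.card using Nat.strong_induction_on generalizing p with
  | _ n ih =>
  obtain ⟨u, hu⟩ := (support_nonempty.mpr hp0)
  by_cases hstep : ∃ φ ∈ Φ, monomialScaling φ p - φ u • p ≠ 0
  · obtain ⟨φ, hφ, hne⟩ := hstep
    have hcoeff : ∀ v, coeff v (monomialScaling φ p - φ u • p) = (φ v - φ u) * coeff v p := by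
      intro v
      rw [coeff_sub, coeff_monomialScaling, coeff_smul, smul_eq_mul, sub_mul]
    have hss : (monomialScaling φ p - φ u • p).support ⊂ p.support := by
      refine (Finset.ssubset_iff_of_subset ?_).mpr ⟨u, hu, ?_⟩
      · intro v hv
        rw [mem_support_iff, hcoeff] at hv
        exact mem_support_iff.mpr (right_ne_zero_of_mul hv)
      · rw [mem_support_iff, hcoeff]
        simp
    exact ih _ (hn ▸ Finset.card_lt_card hss) _
      (V.sub_mem (hΦ φ hφ p hp hpE) (V.smul_mem _ hp))
      (fun v hv => hpE (hss.subset hv)) hne rfl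
  · push Not at hstep
    have huniq : ∀ v ∈ p.support, v = u := by
      intro v hv
      refine hE v (hpE hv) u (hpE hu) fun φ hφ => ?_
      have := congrArg (coeff v) (hstep φ hφ)
      rw [coeff_sub, coeff_monomialScaling, coeff_smul, smul_eq_mul, ← sub_mul, coeff_zero] at this
      exact sub_eq_zero.mp ((mul_eq_zero.mp this).resolve_right (mem_support_iff.mp hv))
    refine ⟨u, hpE hu, ?_⟩
    have hpu : p = monomial u (coeff u p) := by
      ext v
      rw [coeff_monomial]
      split_ifs with h
      · rw [h]
      · by_contra hv
        exact h (huniq v (mem_support_iff.mpr hv)).symm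
    have : monomial u (1 : K) = (coeff u p)⁻¹ • p := by
      conv_rhs => rw [hpu]
      rw [smul_monomial, coeff_monomial, if_pos rfl, smul_eq_mul,
        inv_mul_cancel₀ (mem_support_iff.mp hu)]
    rw [this]
    exact V.smul_mem _ hp

/-- A prime ideal containing a monomial contains one of the variables of that monomial. -/
theorem exists_X_mem_of_monomial_mem {σ K : Type*} [Field K] {I : Ideal (MvPolynomial σ K)}
    (hI : I.IsPrime) {u : σ →₀ ℕ} (hu : monomial u (1 : K) ∈ I) :
    ∃ i ∈ u.support, X i ∈ I := by
  rw [monomial_eq, C_1, one_mul, Finsupp.prod, hI.prod_mem_iff] at hu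
  obtain ⟨i, hi, h⟩ := hu
  exact ⟨i, hi, hI.mem_of_pow_mem _ h⟩

theorem logCanonical_bracket_X {n : ℕ} (Λ : Matrix (Fin n) (Fin n) ℤ)
    (br : MvPolynomial (Fin n) ℂ →ₗ[ℂ] MvPolynomial (Fin n) ℂ →ₗ[ℂ] MvPolynomial (Fin n) ℂ)
    (hbr : ∀ u v : Fin n →₀ ℕ,
      br (monomial u 1) (monomial v 1) =
        ((∑ i, ∑ j, (u i : ℤ) * Λ i j * (v j : ℤ)) : ℤ) • monomial (u + v) (1 : ℂ))
    (k : Fin n) (p : MvPolynomial (Fin n) ℂ) :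
    br (X k) p = X k * monomialScaling (fun v => ((∑ j, Λ k j * (v j : ℤ) : ℤ) : ℂ)) p := by
  suffices h : br (X k) = (LinearMap.mulLeft ℂ (X k)) ∘ₗ
      monomialScaling (fun v => ((∑ j, Λ k j * (v j : ℤ) : ℤ) : ℂ)) by
    rw [h]; rfl
  refine (basisMonomials (Fin n) ℂ).ext fun v => ?_
  rw [coe_basisMonomials, LinearMap.comp_apply, monomialScaling_monomial, LinearMap.mulLeft_apply,
    X, hbr, monomial_mul, one_mul, mul_one]
  have : (∑ i, ∑ j, ((Finsupp.single k 1 : Fin n →₀ ℕ) i : ℤ) * Λ i j * (v j : ℤ))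
      = ∑ j, Λ k j * (v j : ℤ) := by
    rw [Finset.sum_eq_single k]
    · simp
    · intro i _ hi
      simp [Finsupp.single_eq_of_ne hi]
    · simp
  rw [this, ← Int.cast_smul_eq_zsmul ℂ, smul_monomial, smul_eq_mul, mul_one]

theorem aeval_smul_X_eq_monomialScaling {n : ℕ} (b : Fin n → ℤ) (α : ℂˣ)
    (p : MvPolynomial (Fin n) ℂ) :
    aeval (R := ℂ) (fun i => ((α ^ b i : ℂˣ) : ℂ) • (X i : MvPolynomial (Fin n) ℂ)) p =
      monomialScaling (fun v => ((α ^ (∑ i, b i * (v i : ℤ)) : ℂˣ) : ℂ)) p := by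
  suffices h : (aeval (R := ℂ)
      (fun i => ((α ^ b i : ℂˣ) : ℂ) • (X i : MvPolynomial (Fin n) ℂ))).toLinearMap =
      monomialScaling (fun v => ((α ^ (∑ i, b i * (v i : ℤ)) : ℂˣ) : ℂ)) by
    rw [← h]; rfl
  refine (basisMonomials (Fin n) ℂ).ext fun v => ?_
  rw [coe_basisMonomials, monomialScaling_monomial, AlgHom.toLinearMap_apply, aeval_monomial,
    map_one, one_mul, mul_one, monomial_eq, Finsupp.prod_fintype _ _ (by simp),
    Finsupp.prod_fintype _ _ (by simp)]
  simp_rw [smul_eq_C_mul, mul_pow]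
  rw [Finset.prod_mul_distrib]
  congr 1
  simp_rw [← map_pow, ← map_prod]
  congr 1
  have hsum : α ^ (∑ i, b i * (v i : ℤ)) = ∏ i, α ^ (b i * (v i : ℤ)) := by
    have h := map_prod (zpowersHom ℂˣ α)
      (fun i => Multiplicative.ofAdd (b i * (v i : ℤ))) Finset.univ
    rwa [← ofAdd_sum, zpowersHom_apply] at h
  rw [hsum, Units.coe_prod]
  refine Finset.prod_congr rfl fun i _ => ?_
  rw [_root_.zpow_mul, zpow_natCast, Units.val_pow_eq_pow_val]

/-- Under the super-toric condition on `(Λ, T)` (for every subset `s` of the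
index set, the only integer vector `w` supported on `s` with `Λ_s w = 0` and orthogonal to the
projections to `s` of all elements of `T` is `w = 0`), every nonzero `T`-torus-invariant Poisson
prime ideal of `ℂ[x₁,…,xₙ]` (for the log-canonical bracket of `Λ`) is generated by the nonempty
set of variables it contains. -/
theorem toric_poisson_prime_generated_by_variables
    (n : ℕ) (hn : 1 ≤ n)
    (Λ : Matrix (Fin n) (Fin n) ℤ) (hΛ : Λᵀ = -Λ)
    (T : AddSubgroup (Fin n → ℤ))
    (hsupertoric : ∀ s : Finset (Fin n), ∀ w : Fin n → ℤ,
      (∀ i, i ∉ s → w i = 0) →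
      (∀ i ∈ s, ∑ j ∈ s, Λ i j * w j = 0) →
      (∀ b ∈ T, ∑ i ∈ s, w i * b i = 0) → w = 0)
    (br : MvPolynomial (Fin n) ℂ →ₗ[ℂ] MvPolynomial (Fin n) ℂ →ₗ[ℂ] MvPolynomial (Fin n) ℂ)
    (hbr : ∀ u v : Fin n →₀ ℕ,
      br (monomial u 1) (monomial v 1) =
        ((∑ i, ∑ j, (u i : ℤ) * Λ i j * (v j : ℤ)) : ℤ) • monomial (u + v) (1 : ℂ))
    (I : Ideal (MvPolynomial (Fin n) ℂ)) (hIbot : I ≠ ⊥) (hIprime : I.IsPrime)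
    (hIPoisson : ∀ a : MvPolynomial (Fin n) ℂ, ∀ h ∈ I, br a h ∈ I)
    (hItorus : ∀ b ∈ T, ∀ α : ℂˣ,
      I.map (aeval (R := ℂ) fun i => ((α ^ b i : ℂˣ) : ℂ) • X i).toRingHom = I) :
    ({i : Fin n | X i ∈ I}).Nonempty ∧
      I = Ideal.span (MvPolynomial.X '' {i : Fin n | X i ∈ I}) := by
  classical
  let s : Finset (Fin n) := {i | X i ∉ I}
  let E : Set (Fin n →₀ ℕ) := {u | ∀ i ∉ s, u i = 0}
  let α : ℂˣ := Units.mk0 2 two_ne_zero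
  let weight (k : Fin n) : (Fin n →₀ ℕ) → ℂ := fun v => ((∑ j, Λ k j * (v j : ℤ) : ℤ) : ℂ)
  let character (b : Fin n → ℤ) : (Fin n →₀ ℕ) → ℂ :=
    fun v => ((α ^ (∑ i, b i * (v i : ℤ)) : ℂˣ) : ℂ)
  have hs : ∀ i, i ∈ s ↔ X i ∉ I := fun i => by simp [s]
  have hsep : ∀ u ∈ E, ∀ v ∈ E, (∀ φ ∈ weight '' s ∪ character '' T, φ u = φ v) → u = v := by
    intro u hu v hv huv
    have hw : ∀ i, i ∉ s → (u i : ℤ) - v i = 0 := fun i hi => by rw [hu i hi, hv i hi, sub_self]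
    have hext : ∀ c : Fin n → ℤ, ∑ j, c j * (u j : ℤ) = ∑ j, c j * (v j : ℤ) →
        ∑ j ∈ s, c j * ((u j : ℤ) - v j) = 0 := by
      intro c hc
      rw [Finset.sum_subset s.subset_univ fun i _ hi => by rw [hw i hi, mul_zero]]
      simp_rw [mul_sub]
      rw [Finset.sum_sub_distrib, hc, sub_self]
    have h0 := hsupertoric s (fun i => (u i : ℤ) - v i) hw
      (fun k hk => hext _ (Int.cast_injective (huv (weight k) (.inl ⟨k, hk, rfl⟩))))
      (fun b hb => by
        simp_rw [mul_comm _ (b _)]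
        refine hext b ?_
        have h := huv (character b) (.inr ⟨b, hb, rfl⟩)
        simp only [character, α, Units.val_zpow_eq_zpow_val, Units.val_mk0] at h
        have h2 : (2 : ℝ) ^ (∑ i, b i * (u i : ℤ)) = (2 : ℝ) ^ (∑ i, b i * (v i : ℤ)) := by
          simpa only [norm_zpow, Complex.norm_ofNat] using congrArg norm h
        exact zpow_right_injective₀ two_pos (by norm_num) h2)
    ext i
    have := congrFun h0 i
    simp only [Pi.zero_apply] at this
    omega
  have hstable : ∀ φ ∈ weight '' s ∪ character '' T, ∀ q ∈ I.restrictScalars ℂ,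
      (↑q.support : Set (Fin n →₀ ℕ)) ⊆ E → monomialScaling φ q ∈ I.restrictScalars ℂ := by
    rintro φ (⟨k, hk, rfl⟩ | ⟨b, hb, rfl⟩) q hq -
    · have h := hIPoisson (X k) q hq
      rw [logCanonical_bracket_X Λ br hbr] at h
      exact (hIprime.mem_or_mem h).resolve_left ((hs k).mp hk)
    · have h := Ideal.mem_map_of_mem
        (aeval (R := ℂ) fun i => ((α ^ b i : ℂˣ) : ℂ) •
          (X i : MvPolynomial (Fin n) ℂ)).toRingHom hq
      rw [hItorus b hb α] at h
      exact aeval_smul_X_eq_monomialScaling b α q ▸ h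
  have hzero : ∀ p ∈ I, (↑p.support : Set (Fin n →₀ ℕ)) ⊆ E → p = 0 := by
    intro p hp hpE
    by_contra hp0
    obtain ⟨u, huE, hu⟩ := exists_monomial_mem_of_separating_scalings
      (I.restrictScalars ℂ) E (weight '' s ∪ character '' T) hsep hstable p hp hpE hp0
    obtain ⟨i, hi, hXi⟩ := exists_X_mem_of_monomial_mem hIprime hu
    exact Finsupp.mem_support_iff.mp hi (huE i fun h => (hs i).mp h hXi)
  have hspan : I = Ideal.span (MvPolynomial.X '' {i : Fin n | X i ∈ I}) := by
    have hle : Ideal.span (MvPolynomial.X '' {i : Fin n | X i ∈ I}) ≤ I := by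
      rw [Ideal.span_le]
      rintro _ ⟨i, hi, rfl⟩
      exact hi
    refine le_antisymm (fun p hp => ?_) hle
    let q := monomialScaling (fun u => if u ∈ E then 1 else 0) p
    have hsub : p - q ∈ Ideal.span (MvPolynomial.X '' {i : Fin n | X i ∈ I}) := by
      rw [mem_ideal_span_X_image]
      intro u hu
      rw [mem_support_iff, coeff_sub, coeff_monomialScaling] at hu
      by_contra! hu'
      refine hu ?_
      have huE : u ∈ E := fun i hi => hu' i (by_contra fun h => hi ((hs i).mpr h))
      rw [if_pos huE, one_mul, sub_self]
    have hq : q = 0 := by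
      refine hzero q ?_ fun u hu => ?_
      · simpa using I.sub_mem hp (hle hsub)
      · by_contra huE
        refine mem_support_iff.mp hu ?_
        rw [coeff_monomialScaling, if_neg huE, zero_mul]
    simpa [hq] using hsub
  refine ⟨?_, hspan⟩
  by_contra hne
  rw [Set.not_nonempty_iff_eq_empty] at hne
  rw [hne, Set.image_empty, Ideal.span_empty] at hspan
  exact hIbot hspan
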